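/- Let q > 2 be a prime power and let C be any linear code over GF(q) of length q² + 1, dimension 4, and minimum distance q² − q (an ovoid code; such codes are exactly the codes whose generator-matrix columns form an ovoid in PG(3, GF(q))). Then the dual code C⊥ has dimension q² − 3 and minimum distance 4, the code C has minimum linear locality 3, and the dual code C⊥ has minimum linear locality q² − q − 1. -/

import Mathlib

open scoped BigOperators

variable {F : Type*} [Field F] {ι : Type*} [Fintype ι]

/-- The Hamming weight of a word: the number of nonzero coordinates. -/
noncomputable def wt (c : ι → F) : ℕ := {i | c i ≠ 0}.ncard

/-- The minimum distance of a linear code: the least Hamming weight of a nonzero codeword. -/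
noncomputable def minDist (C : Submodule F (ι → F)) : ℕ :=
  sInf {w | ∃ c ∈ C, c ≠ 0 ∧ wt c = w}

/-- The dual code of a linear code. -/
def dualCode (C : Submodule F (ι → F)) : Submodule F (ι → F) where
  carrier := {x | ∀ c ∈ C, ∑ i, x i * c i = 0}
  add_mem' := by
    intro a b ha hb c hc
    have h1 := ha c hc
    have h2 := hb c hc
    simp only [Set.mem_setOf_eq, Pi.add_apply, add_mul, Finset.sum_add_distrib, h1, h2, add_zero]
  zero_mem' := by intro c hc; simp
  smul_mem' := by
    intro r a ha c hc
    have h := ha c hc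
    simp only [Set.mem_setOf_eq, Pi.smul_apply, smul_eq_mul, mul_assoc, ← Finset.mul_sum, h,
      mul_zero]

/-- `C` has linear locality `r`: every code symbol `c i` is a fixed linear combination of
at most `r` other code symbols. -/
def HasLinearLocality (C : Submodule F (ι → F)) (r : ℕ) : Prop :=
  ∀ i : ι, ∃ (R : Finset ι) (u : ι → F), i ∉ R ∧ R.card ≤ r ∧
    ∀ c ∈ C, c i = ∑ j ∈ R, u j * c j

lemma wt_eq_card_filter [DecidableEq F] (c : ι → F) :
    wt c = (Finset.univ.filter fun i => c i ≠ 0).card := by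
  rw [wt, ← Set.ncard_coe_finset]
  simp

lemma card_zeros_add_wt [DecidableEq F] (c : ι → F) :
    (Finset.univ.filter fun i => c i = 0).card + wt c = Fintype.card ι := by
  rw [wt_eq_card_filter]
  exact Finset.card_filter_add_card_filter_not _

lemma minDist_le_wt {C : Submodule F (ι → F)} {c : ι → F} (hc : c ∈ C) (h0 : c ≠ 0) :
    minDist C ≤ wt c :=
  Nat.sInf_le ⟨c, hc, h0, rfl⟩

lemma mem_dualCode {C : Submodule F (ι → F)} {x : ι → F} :
    x ∈ dualCode C ↔ ∀ c ∈ C, ∑ i, x i * c i = 0 :=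
  Iff.rfl

lemma dualCode_eq_comap_dualAnnihilator [DecidableEq ι] (C : Submodule F (ι → F)) :
    dualCode C =
      C.dualAnnihilator.comap ((Pi.basisFun F ι).toDualEquiv : (ι → F) →ₗ[F] _) := by
  ext x
  simp only [mem_dualCode, Submodule.mem_comap, Submodule.mem_dualAnnihilator]
  refine forall₂_congr fun c _ => ?_
  have h : (Pi.basisFun F ι).toDual x c = ∑ i, x i * c i := by
    conv_lhs => rw [← (Pi.basisFun F ι).sum_repr c, map_sum]
    refine Finset.sum_congr rfl fun i _ => ?_
    rw [map_smul, Module.Basis.toDual_apply_left, Pi.basisFun_repr, Pi.basisFun_repr,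
      smul_eq_mul, mul_comm]
  rw [LinearEquiv.coe_coe, Module.Basis.toDualEquiv_apply, h]

lemma finrank_add_finrank_dualCode (C : Submodule F (ι → F)) :
    Module.finrank F C + Module.finrank F (dualCode C) = Fintype.card ι := by
  classical
  rw [dualCode_eq_comap_dualAnnihilator, Submodule.comap_equiv_eq_map_symm,
    LinearEquiv.finrank_map_eq, Subspace.finrank_add_finrank_dualAnnihilator_eq,
    Module.finrank_fintype_fun_eq_card]

lemma dualCode_dualCode (C : Submodule F (ι → F)) : dualCode (dualCode C) = C := by
  symm
  apply Submodule.eq_of_le_of_finrank_eq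
  · intro c hc x hx
    simpa [mul_comm] using hx c hc
  · have h₁ := finrank_add_finrank_dualCode C
    have h₂ := finrank_add_finrank_dualCode (dualCode C)
    omega

/-- Linear locality `r` means that every coordinate lies in the support of a dual codeword of
weight at most `r + 1`. -/
lemma hasLinearLocality_iff {C : Submodule F (ι → F)} {r : ℕ} :
    HasLinearLocality C r ↔ ∀ i, ∃ x ∈ dualCode C, x i ≠ 0 ∧ wt x ≤ r + 1 := by
  classical
  refine forall_congr' fun i => ⟨?_, ?_⟩
  · rintro ⟨R, u, hi, hR, h⟩
    refine ⟨fun j => (if j = i then 1 else 0) - if j ∈ R then u j else 0, fun c hc => ?_, ?_, ?_⟩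
    · simp [sub_mul, Finset.sum_sub_distrib, h c hc]
    · simp [hi]
    · rw [wt_eq_card_filter]
      refine (Finset.card_le_card (t := insert i R) fun j hj => ?_).trans
        ((Finset.card_insert_le _ _).trans (by omega))
      by_contra hj'
      simp_all
  · rintro ⟨x, hx, hi, hw⟩
    rw [wt_eq_card_filter] at hw
    refine ⟨(Finset.univ.filter fun j => x j ≠ 0).erase i, fun j => -((x i)⁻¹ * x j), by simp,
      ?_, fun c hc => ?_⟩
    · rw [Finset.card_erase_of_mem (by simpa using hi)]
      omega
    · have h := hx c hc
      rw [← Finset.sum_filter_of_ne (p := fun j => x j ≠ 0)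
        (fun j _ hj => left_ne_zero_of_mul hj),
        ← Finset.add_sum_erase _ _ (show i ∈ _ by simpa using hi)] at h
      simp only [neg_mul, Finset.sum_neg_distrib, mul_assoc, ← Finset.mul_sum]
      rw [eq_neg_of_add_eq_zero_right h]
      field_simp

lemma exists_le_finrank_eq {V : Type*} [AddCommGroup V] [Module F V] [FiniteDimensional F V]
    (W : Submodule F V) {n : ℕ} (h : n ≤ Module.finrank F W) :
    ∃ D ≤ W, Module.finrank F D = n := by
  obtain ⟨f, hf⟩ := exists_linearIndependent_of_le_finrank h
  refine ⟨Submodule.span F (Set.range fun i => (f i : V)), ?_, ?_⟩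
  · rw [Submodule.span_le]
    rintro _ ⟨i, rfl⟩
    exact (f i).2
  · exact (finrank_span_eq_card (hf.map' W.subtype W.ker_subtype)).trans (Fintype.card_fin n)

/-- The subcode of the words of `C` that vanish on `S`. -/
def vanishingSubcode (C : Submodule F (ι → F)) (S : Finset ι) : Submodule F (ι → F) :=
  C ⊓ LinearMap.ker (LinearMap.funLeft F F (Subtype.val : S → ι))

lemma mem_vanishingSubcode {C : Submodule F (ι → F)} {S : Finset ι} {c : ι → F} :
    c ∈ vanishingSubcode C S ↔ c ∈ C ∧ ∀ i ∈ S, c i = 0 := by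
  simp [vanishingSubcode, funext_iff, LinearMap.funLeft_apply]

lemma finrank_le_finrank_vanishingSubcode_add_card (C : Submodule F (ι → F)) (S : Finset ι) :
    Module.finrank F C ≤ Module.finrank F (vanishingSubcode C S) + S.card := by
  have h₁ := Submodule.finrank_sup_add_finrank_inf_eq C
    (LinearMap.ker (LinearMap.funLeft F F (Subtype.val : S → ι)))
  have h₂ := Submodule.finrank_le
    (C ⊔ LinearMap.ker (LinearMap.funLeft F F (Subtype.val : S → ι)))
  have h₃ := LinearMap.finrank_range_add_finrank_ker
    (LinearMap.funLeft F F (Subtype.val : S → ι))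
  have h₄ := Submodule.finrank_le
    (LinearMap.range (LinearMap.funLeft F F (Subtype.val : S → ι)))
  simp only [Module.finrank_fintype_fun_eq_card, Fintype.card_coe] at h₂ h₃ h₄
  rw [vanishingSubcode]
  omega

/-- Double counting of the zeros of the words of a two-dimensional code. -/
lemma sum_card_zeros_of_finrank_eq_two [Fintype F] [DecidableEq F] [DecidableEq ι]
    (D : Submodule F (ι → F)) [Fintype D]
    (hD : Module.finrank F D = 2) (T : Finset ι) (hT : ∀ i, i ∈ T ↔ ∀ c ∈ D, c i = 0) :
    ∑ c : D, (Finset.univ.filter fun i => (c : ι → F) i = 0).card =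
      T.card * Fintype.card F ^ 2 + Tᶜ.card * Fintype.card F := by
  have key : ∀ i, (Finset.univ.filter fun c : D => (c : ι → F) i = 0).card =
      if i ∈ T then Fintype.card F ^ 2 else Fintype.card F := by
    intro i
    split_ifs with hi
    · rw [hT] at hi
      rw [Finset.filter_true_of_mem (by rintro ⟨c, hc⟩ _; exact hi c hc), Finset.card_univ,
        Module.card_eq_pow_finrank (K := F), hD]
    · let f : Module.Dual F D := (LinearMap.proj i).comp D.subtype
      have hf : f ≠ 0 := fun h => hi ((hT i).2 fun c hc => LinearMap.congr_fun h ⟨c, hc⟩)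
      have h₁ := Module.Dual.finrank_ker_add_one_of_ne_zero hf
      have h₂ : Module.finrank F (LinearMap.ker f) = 1 := by omega
      classical
      have h₃ := Module.natCard_eq_pow_finrank (K := F) (V := LinearMap.ker f)
      rw [h₂, pow_one, Nat.card_eq_fintype_card (α := F)] at h₃
      rw [← h₃, Nat.card_eq_fintype_card, Fintype.card_subtype]
      simp [f]
  have h := Finset.sum_card_bipartiteAbove_eq_sum_card_bipartiteBelow
    (s := (Finset.univ : Finset D)) (t := (Finset.univ : Finset ι))
    (fun (c : D) i => (c : ι → F) i = 0)
  simp only [Finset.bipartiteAbove, Finset.bipartiteBelow, key] at h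
  rw [h, Finset.sum_ite]
  simp [Finset.filter_not, Finset.compl_eq_univ_sdiff]

/-- In a code of length `q² + 1` and minimum distance at least `q² - q`, the words of a
two-dimensional subcode have at most two common zeros, and if they have two, then every nonzero
word of the subcode has weight `q² - q`. -/
lemma card_commonZeros_le_two [Fintype F] [DecidableEq F] [DecidableEq ι] {q : ℕ}
    (hq : Fintype.card F = q) (hn : Fintype.card ι = q ^ 2 + 1) {D : Submodule F (ι → F)}
    (hD : Module.finrank F D = 2) (hw : ∀ c ∈ D, c ≠ 0 → q ^ 2 - q ≤ wt c)
    (T : Finset ι) (hT : ∀ i, i ∈ T ↔ ∀ c ∈ D, c i = 0) :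
    T.card ≤ 2 ∧ (T.card = 2 → ∀ c ∈ D, c ≠ 0 → wt c = q ^ 2 - q) := by
  classical
  have hq1 : 1 < q := hq ▸ Fintype.one_lt_card
  have hqq : q < q ^ 2 := by nlinarith
  have : Fintype D := Fintype.ofFinite D
  have hsum := sum_card_zeros_of_finrank_eq_two D hD T hT
  have hz : ∀ c ∈ (Finset.univ : Finset D).erase 0,
      (Finset.univ.filter fun i => (c : ι → F) i = 0).card ≤ q + 1 := by
    intro c hc
    have h₁ := hw c c.2 (by simpa using hc)
    have h₂ := card_zeros_add_wt (c : ι → F)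
    omega
  have hcard : ((Finset.univ : Finset D).erase 0).card + 1 = q ^ 2 := by
    rw [Finset.card_erase_add_one (Finset.mem_univ _), Finset.card_univ,
      Module.card_eq_pow_finrank (K := F), hD, hq]
  have hle := Finset.sum_le_sum hz
  rw [← Finset.add_sum_erase _ _ (Finset.mem_univ (0 : D))] at hsum
  simp only [ZeroMemClass.coe_zero, Pi.zero_apply, Finset.filter_true, Finset.card_univ, hn, hq]
    at hsum
  have hT' : T.card + Tᶜ.card = q ^ 2 + 1 := by rw [Finset.card_add_card_compl, hn]
  rw [Finset.sum_const, smul_eq_mul] at hle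
  refine ⟨?_, fun h2 c hc h0 => ?_⟩
  · by_contra! h3
    nlinarith
  · have heq : ∑ c ∈ (Finset.univ : Finset D).erase 0,
        (Finset.univ.filter fun i => (c : ι → F) i = 0).card =
        ∑ c ∈ (Finset.univ : Finset D).erase 0, (q + 1) := by
      rw [Finset.sum_const, smul_eq_mul]
      rw [h2] at hsum hT'
      nlinarith
    have h₁ := (Finset.sum_eq_sum_iff_of_le hz).1 heq ⟨c, hc⟩ (by simpa using h0)
    have h₂ := card_zeros_add_wt c
    simp only at h₁
    omega

/-- The words of an ovoid code that vanish on three or more coordinates are proportional. -/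
lemma finrank_vanishingSubcode_le_one [Fintype F] {q : ℕ}
    (hq : Fintype.card F = q) (hn : Fintype.card ι = q ^ 2 + 1) {C : Submodule F (ι → F)}
    (hw : ∀ c ∈ C, c ≠ 0 → q ^ 2 - q ≤ wt c) {S : Finset ι} (hS : 3 ≤ S.card) :
    Module.finrank F (vanishingSubcode C S) ≤ 1 := by
  classical
  by_contra! h
  obtain ⟨D, hDS, hD⟩ := exists_le_finrank_eq (n := 2) _ h
  have h₁ := (card_commonZeros_le_two hq hn hD
    (fun c hc => hw c (mem_vanishingSubcode.1 (hDS hc)).1)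
    (Finset.univ.filter fun i => ∀ c ∈ D, c i = 0) (by simp)).1
  have h₂ : S.card ≤ (Finset.univ.filter fun i => ∀ c ∈ D, c i = 0).card :=
    Finset.card_le_card fun i hi => by
      simpa using fun c hc => (mem_vanishingSubcode.1 (hDS hc)).2 i hi
  omega

/-- The planes through two points of an ovoid form a pencil of secant planes: the corresponding
words have minimum weight, and the two points are their only common zeros. -/
lemma exists_pencil [Fintype F] {q : ℕ}
    (hq : Fintype.card F = q) (hn : Fintype.card ι = q ^ 2 + 1) {C : Submodule F (ι → F)}
    (hdim : Module.finrank F C = 4) (hw : ∀ c ∈ C, c ≠ 0 → q ^ 2 - q ≤ wt c)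
    {j k : ι} (hjk : j ≠ k) :
    ∃ D ≤ C, Module.finrank F D = 2 ∧ (∀ i, (∀ c ∈ D, c i = 0) ↔ i = j ∨ i = k) ∧
      ∀ c ∈ D, c ≠ 0 → wt c = q ^ 2 - q := by
  classical
  have h := finrank_le_finrank_vanishingSubcode_add_card C {j, k}
  rw [hdim, Finset.card_pair hjk] at h
  obtain ⟨D, hDS, hD⟩ := exists_le_finrank_eq (n := 2) (vanishingSubcode C {j, k}) (by omega)
  have hDC : D ≤ C := fun c hc => (mem_vanishingSubcode.1 (hDS hc)).1
  have hsub : ({j, k} : Finset ι) ⊆ Finset.univ.filter fun i => ∀ c ∈ D, c i = 0 :=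
    fun i hi => by simpa using fun c hc => (mem_vanishingSubcode.1 (hDS hc)).2 i hi
  obtain ⟨h₁, h₂⟩ := card_commonZeros_le_two hq hn hD (fun c hc => hw c (hDC hc))
    (Finset.univ.filter fun i => ∀ c ∈ D, c i = 0) (by simp)
  have heq := Finset.eq_of_subset_of_card_le hsub (by rwa [Finset.card_pair hjk])
  refine ⟨D, hDC, hD, fun i => ?_, h₂ (by rw [← heq, Finset.card_pair hjk])⟩
  simpa using (Finset.ext_iff.1 heq i).symm

lemma four_le_wt_of_mem_dualCode [Fintype F] {q : ℕ}
    (hq : Fintype.card F = q) (hq2 : 2 < q) (hn : Fintype.card ι = q ^ 2 + 1)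
    {C : Submodule F (ι → F)} (hdim : Module.finrank F C = 4)
    (hw : ∀ c ∈ C, c ≠ 0 → q ^ 2 - q ≤ wt c) {x : ι → F} (hx : x ∈ dualCode C) (h0 : x ≠ 0) :
    4 ≤ wt x := by
  classical
  by_contra! hlt
  rw [wt_eq_card_filter] at hlt
  obtain ⟨i, hi⟩ := Function.ne_iff.1 h0
  have hqq : 3 * 3 ≤ q ^ 2 := by nlinarith
  have hcard : ((Finset.univ.filter fun j => x j ≠ 0).erase i).card ≤ 2 := by
    rw [Finset.card_erase_of_mem (by simpa using hi)]
    omega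
  obtain ⟨S, hS₁, hS₂, hS⟩ := Finset.exists_subsuperset_card_eq
    (s := (Finset.univ.filter fun j => x j ≠ 0).erase i) (t := Finset.univ.erase i)
    (Finset.erase_subset_erase _ (Finset.subset_univ _)) hcard
    (by rw [Finset.card_erase_of_mem (Finset.mem_univ _), Finset.card_univ, hn]; omega)
  obtain ⟨j, k, hjk, rfl⟩ := Finset.card_eq_two.1 hS
  obtain ⟨D, hDC, -, hz, -⟩ := exists_pencil hq hn hdim hw hjk
  have hi' : ¬ (i = j ∨ i = k) := fun h =>
    (Finset.mem_erase.1 (hS₂ (show i ∈ ({j, k} : Finset ι) by simpa using h))).1 rfl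
  rw [← hz] at hi'
  push Not at hi'
  obtain ⟨c, hc, hci⟩ := hi'
  have h := hx c (hDC hc)
  rw [Finset.sum_eq_single i] at h
  · exact mul_ne_zero hi hci h
  · intro l _ hl
    by_cases hxl : x l = 0
    · rw [hxl, zero_mul]
    · have : l ∈ ({j, k} : Finset ι) := hS₁ (by simp [hl, hxl])
      rw [(hz l).2 (by simpa using this) c hc, mul_zero]
  · simp

lemma hasLinearLocality_three [Fintype F] {q : ℕ}
    (hq : Fintype.card F = q) (hq2 : 2 < q) (hn : Fintype.card ι = q ^ 2 + 1)
    {C : Submodule F (ι → F)} (hdim : Module.finrank F C = 4)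
    (hw : ∀ c ∈ C, c ≠ 0 → q ^ 2 - q ≤ wt c) : HasLinearLocality C 3 := by
  classical
  intro i
  have hqq : 3 * q ≤ q ^ 2 := by nlinarith
  have : Nontrivial ι := Fintype.one_lt_card_iff_nontrivial.1 (by omega)
  obtain ⟨j, hj⟩ := exists_ne i
  obtain ⟨D, hDC, hD, hz, hwt⟩ := exists_pencil hq hn hdim hw hj.symm
  obtain ⟨c, hc, h0⟩ := D.exists_mem_ne_zero_of_ne_bot (by rintro rfl; simp at hD)
  have hci := (hz i).2 (Or.inl rfl) c hc
  have hcard := card_zeros_add_wt c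
  rw [hwt c hc h0] at hcard
  obtain ⟨S, hS, hS3⟩ := Finset.exists_subset_card_eq
    (s := (Finset.univ.filter fun l => c l = 0).erase i) (n := 3)
    (by rw [Finset.card_erase_of_mem (by simpa using hci)]; omega)
  have hcS : c ∈ vanishingSubcode C S := mem_vanishingSubcode.2
    ⟨hDC hc, fun l hl => by simpa using Finset.mem_of_mem_erase (hS hl)⟩
  have hfin := finrank_vanishingSubcode_le_one hq hn hw hS3.ge
  have hvan : ∀ b ∈ vanishingSubcode C S, b i = 0 := by
    intro b hb
    have hspan : Submodule.span F {c} = vanishingSubcode C S :=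
      Submodule.eq_of_le_of_finrank_le (by simpa using hcS)
        (by rwa [finrank_span_singleton h0])
    rw [← hspan] at hb
    obtain ⟨a, rfl⟩ := Submodule.mem_span_singleton.1 hb
    simp [hci]
  have hmem := mem_span_of_iInf_ker_le_ker
    (L := fun l : S => (LinearMap.proj (l : ι)).comp C.subtype)
    (K := (LinearMap.proj i : (ι → F) →ₗ[F] F).comp C.subtype) (by
      intro b hb
      simp only [Submodule.mem_iInf, LinearMap.mem_ker, LinearMap.comp_apply,
        Submodule.subtype_apply, LinearMap.proj_apply, Subtype.forall] at hb ⊢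
      exact hvan b (mem_vanishingSubcode.2 ⟨b.2, hb⟩))
  obtain ⟨u, hu⟩ := (Submodule.mem_span_range_iff_exists_fun F).1 hmem
  refine ⟨S, fun l => if hl : l ∈ S then u ⟨l, hl⟩ else 0,
    fun h => (Finset.mem_erase.1 (hS h)).1 rfl, hS3.le, fun b hb => ?_⟩
  have h := LinearMap.congr_fun hu ⟨b, hb⟩
  simp only [LinearMap.sum_apply, LinearMap.smul_apply, LinearMap.comp_apply,
    Submodule.subtype_apply, LinearMap.proj_apply, smul_eq_mul] at h
  rw [← h, ← Finset.sum_coe_sort S]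
  simp

lemma exists_wt_eq_of_ne_zero [Fintype F] {q : ℕ}
    (hq : Fintype.card F = q) (hq2 : 2 < q) (hn : Fintype.card ι = q ^ 2 + 1)
    {C : Submodule F (ι → F)} (hdim : Module.finrank F C = 4)
    (hw : ∀ c ∈ C, c ≠ 0 → q ^ 2 - q ≤ wt c) (i : ι) :
    ∃ c ∈ C, c i ≠ 0 ∧ wt c = q ^ 2 - q := by
  classical
  have hqq : 3 * 3 ≤ q ^ 2 := by nlinarith
  obtain ⟨S, hS, hS2⟩ := Finset.exists_subset_card_eq
    (s := (Finset.univ : Finset ι).erase i) (n := 2)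
    (by rw [Finset.card_erase_of_mem (Finset.mem_univ _), Finset.card_univ, hn]; omega)
  obtain ⟨j, k, hjk, rfl⟩ := Finset.card_eq_two.1 hS2
  obtain ⟨D, hDC, -, hz, hwt⟩ := exists_pencil hq hn hdim hw hjk
  have hi : ¬ (i = j ∨ i = k) := fun h =>
    (Finset.mem_erase.1 (hS (show i ∈ ({j, k} : Finset ι) by simpa using h))).1 rfl
  rw [← hz] at hi
  push Not at hi
  obtain ⟨c, hc, hci⟩ := hi
  exact ⟨c, hDC hc, hci, hwt c hc fun h => hci (by simp [h])⟩

/-- Any `[q² + 1, 4, q² - q]` code over `GF(q)`, `q > 2` (an ovoid code), has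
dual of dimension `q² - 3` and minimum distance `4`; the code has minimum linear locality `3`
and its dual has minimum linear locality `q² - q - 1`. -/
theorem statement12 {F : Type*} [Field F] [Fintype F] (q : ℕ)
    (hq : Fintype.card F = q) (hq2 : 2 < q)
    (C : Submodule F (Fin (q ^ 2 + 1) → F))
    (hdim : Module.finrank F C = 4) (hd : minDist C = q ^ 2 - q) :
    Module.finrank F (dualCode C) = q ^ 2 - 3 ∧
    minDist (dualCode C) = 4 ∧
    IsLeast {r : ℕ | HasLinearLocality C r} 3 ∧
    IsLeast {r : ℕ | HasLinearLocality (dualCode C) r} (q ^ 2 - q - 1) := by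
  have hn : Fintype.card (Fin (q ^ 2 + 1)) = q ^ 2 + 1 := Fintype.card_fin _
  have hqq : 3 * q ≤ q ^ 2 := by nlinarith
  have hw : ∀ c ∈ C, c ≠ 0 → q ^ 2 - q ≤ wt c := fun c hc h0 => hd ▸ minDist_le_wt hc h0
  have hdual : ∀ x ∈ dualCode C, x ≠ 0 → 4 ≤ wt x := fun x hx h0 =>
    four_le_wt_of_mem_dualCode hq hq2 hn hdim hw hx h0
  have hloc := hasLinearLocality_three hq hq2 hn hdim hw
  refine ⟨?_, ?_, ⟨hloc, fun r hr => ?_⟩, ⟨?_, fun r hr => ?_⟩⟩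
  · have h := finrank_add_finrank_dualCode C
    omega
  · obtain ⟨x, hx, hxi, hwx⟩ := hasLinearLocality_iff.1 hloc 0
    have h0 : x ≠ 0 := fun h => hxi (by simp [h])
    refine le_antisymm ((minDist_le_wt hx h0).trans hwx) (le_csInf ⟨_, x, hx, h0, rfl⟩ ?_)
    rintro _ ⟨y, hy, hy0, rfl⟩
    exact hdual y hy hy0
  · obtain ⟨x, hx, hxi, hwx⟩ := hasLinearLocality_iff.1 hr 0
    have := hdual x hx fun h => hxi (by simp [h])
    omega
  · refine hasLinearLocality_iff.2 fun i => ?_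
    obtain ⟨c, hc, hci, hwc⟩ := exists_wt_eq_of_ne_zero hq hq2 hn hdim hw i
    exact ⟨c, by rwa [dualCode_dualCode], hci, by omega⟩
  · obtain ⟨x, hx, hxi, hwx⟩ := hasLinearLocality_iff.1 hr 0
    rw [dualCode_dualCode] at hx
    have := hw x hx fun h => hxi (by simp [h])
    omega
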